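/- arXiv:2308.03502 — 2 statements merged into one kernel-verified Lean document; each statement's English description precedes it below -/
import Mathlib

section
/- Let α, β ∈ (0,1) with α + β ≤ 1 and let f ∈ AC[0,1]. Then ∂^α (D^β f) = D^{α+β} f almost everywhere in (0,1) (where for α + β = 1 one interprets D¹f = f′). In particular, ∂^{1−α}(D^α f) = f′ almost everywhere in (0,1). -/
open MeasureTheory Set

/-- The Riemann–Liouville fractional integral of order `α` (lower limit `0`). -/
noncomputable def fracInt (α : ℝ) (f : ℝ → ℝ) (x : ℝ) : ℝ :=
  (1 / Real.Gamma α) * ∫ p in (0:ℝ)..x, (x - p) ^ (α - 1) * f p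

/-- The Riemann–Liouville fractional derivative of order `α ∈ (0,1)`. -/
noncomputable def rlDeriv (α : ℝ) (f : ℝ → ℝ) (x : ℝ) : ℝ :=
  deriv (fracInt (1 - α) f) x

/-- The Caputo fractional derivative of order `α ∈ (0,1)`. -/
noncomputable def caputo (α : ℝ) (f : ℝ → ℝ) (x : ℝ) : ℝ :=
  deriv (fracInt (1 - α) (fun p => f p - f 0)) x

lemma integral_beta_kernel {a b s x : ℝ} (ha : 0 < a) (hb : 0 < b) (hsx : s < x) :
    ∫ p in s..x, (x - p) ^ (a - 1) * (p - s) ^ (b - 1) =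
      ProbabilityTheory.beta a b * (x - s) ^ (a + b - 1) := by
  have hc : 0 < x - s := sub_pos.2 hsx
  have hshift : ∫ p in s..x, (x - p) ^ (a - 1) * (p - s) ^ (b - 1) =
      ∫ y in (0:ℝ)..(x - s), y ^ (b - 1) * ((x - s) - y) ^ (a - 1) := by
    have h := intervalIntegral.integral_comp_sub_right (a := s) (b := x)
      (fun y : ℝ => y ^ (b - 1) * ((x - s) - y) ^ (a - 1)) s
    rw [sub_self] at h
    rw [← h]
    refine intervalIntegral.integral_congr fun p _ => ?_
    simp only [sub_sub_sub_cancel_right, mul_comm]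
  rw [hshift]
  have hbeta := Complex.betaIntegral_scaled (b : ℂ) (a : ℂ) hc
  have hval : Complex.betaIntegral b a = ((ProbabilityTheory.beta a b : ℝ) : ℂ) := by
    rw [Complex.betaIntegral_eq_Gamma_mul_div _ _ (by simpa) (by simpa), ProbabilityTheory.beta]
    simp only [← Complex.ofReal_add, Complex.Gamma_ofReal]
    rw [add_comm b a]
    push_cast
    ring
  have hleft : ∫ y in (0:ℝ)..(x - s),
      (y : ℂ) ^ ((b : ℂ) - 1) * (((x - s : ℝ) : ℂ) - y) ^ ((a : ℂ) - 1) =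
      ((∫ y in (0:ℝ)..(x - s), y ^ (b - 1) * ((x - s) - y) ^ (a - 1) : ℝ) : ℂ) := by
    rw [← intervalIntegral.integral_ofReal]
    refine intervalIntegral.integral_congr fun y hy => ?_
    rw [uIcc_of_le hc.le] at hy
    simp only [Complex.ofReal_mul]
    rw [Complex.ofReal_cpow hy.1, Complex.ofReal_cpow (sub_nonneg.2 hy.2)]
    push_cast
    rfl
  rw [hleft, hval] at hbeta
  have hpow : ((x - s : ℝ) : ℂ) ^ ((b : ℂ) + a - 1) = (((x - s) ^ (a + b - 1) : ℝ) : ℂ) := by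
    rw [Complex.ofReal_cpow hc.le, add_comm (b : ℂ)]
    push_cast
    rfl
  rw [hpow] at hbeta
  rw [mul_comm]
  exact_mod_cast hbeta

lemma intervalIntegrable_beta_kernel {a b s x : ℝ} (ha : 0 < a) (hb : 0 < b) (hsx : s < x) :
    IntervalIntegrable (fun p => (x - p) ^ (a - 1) * (p - s) ^ (b - 1)) volume s x := by
  apply intervalIntegral.intervalIntegrable_of_integral_ne_zero
  rw [integral_beta_kernel ha hb hsx]
  exact (mul_pos (ProbabilityTheory.beta_pos ha hb)
    (Real.rpow_pos_of_pos (sub_pos.2 hsx) _)).ne'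

/-- The integrand `(p, s) ↦ (x - p) ^ (a - 1) * (p - s) ^ (b - 1) * h s` of an iterated fractional
integral, cut off to the triangle `s < p`. -/
noncomputable def iteratedKernel (a b x : ℝ) (h : ℝ → ℝ) (p s : ℝ) : ℝ :=
  (Ioi s).indicator (fun p => (x - p) ^ (a - 1) * (p - s) ^ (b - 1)) p * h s

lemma integrable_iteratedKernel_left {a b s x : ℝ} (ha : 0 < a) (hb : 0 < b) (h : ℝ → ℝ)
    (hs : 0 < s) (hsx : s < x) :
    Integrable (fun p => iteratedKernel a b x h p s) (volume.restrict (Ioc 0 x)) := by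
  refine Integrable.mul_const ?_ _
  rw [integrable_indicator_iff measurableSet_Ioi, IntegrableOn,
    Measure.restrict_restrict measurableSet_Ioi, inter_comm, Ioc_inter_Ioi, max_eq_right hs.le]
  exact (intervalIntegrable_iff_integrableOn_Ioc_of_le hsx.le).1
    (intervalIntegrable_beta_kernel ha hb hsx)

lemma integral_iteratedKernel_left {a b s x : ℝ} (ha : 0 < a) (hb : 0 < b) (h : ℝ → ℝ)
    (hs : 0 < s) (hsx : s < x) :
    ∫ p in Ioc 0 x, iteratedKernel a b x h p s =
      ProbabilityTheory.beta a b * ((x - s) ^ (a + b - 1) * h s) := by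
  simp only [iteratedKernel]
  rw [integral_mul_const, integral_indicator measurableSet_Ioi,
    Measure.restrict_restrict measurableSet_Ioi, inter_comm, Ioc_inter_Ioi, max_eq_right hs.le,
    ← intervalIntegral.integral_of_le hsx.le, integral_beta_kernel ha hb hsx, mul_assoc]

lemma norm_iteratedKernel {a b p s x : ℝ} (h : ℝ → ℝ) (hpx : p ≤ x) :
    ‖iteratedKernel a b x h p s‖ = iteratedKernel a b x (fun s => |h s|) p s := by
  rw [iteratedKernel, iteratedKernel, norm_mul, Real.norm_eq_abs, Real.norm_eq_abs, abs_of_nonneg]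
  exact indicator_apply_nonneg fun hps => mul_nonneg (Real.rpow_nonneg (sub_nonneg.2 hpx) _)
    (Real.rpow_nonneg (sub_nonneg.2 (le_of_lt hps)) _)

lemma integral_iteratedKernel_right {a b p x : ℝ} (h : ℝ → ℝ) (hp : 0 < p) (hpx : p ≤ x) :
    ∫ s in Ioc 0 x, iteratedKernel a b x h p s =
      (x - p) ^ (a - 1) * ∫ s in (0:ℝ)..p, (p - s) ^ (b - 1) * h s := by
  have hind : (fun s => iteratedKernel a b x h p s) =
      (Iio p).indicator (fun s => (x - p) ^ (a - 1) * ((p - s) ^ (b - 1) * h s)) := by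
    ext s
    by_cases hs : s < p <;> simp [iteratedKernel, hs, mul_assoc]
  rw [hind, integral_indicator measurableSet_Iio, Measure.restrict_restrict measurableSet_Iio,
    integral_const_mul, intervalIntegral.integral_of_le hp.le, integral_Ioc_eq_integral_Ioo]
  congr 3
  ext s
  simp only [mem_inter_iff, mem_Iio, mem_Ioc, mem_Ioo]
  grind

lemma integrable_iteratedKernel {a b x : ℝ} (ha : 0 < a) (hb : 0 < b) (hab : 1 ≤ a + b)
    {h : ℝ → ℝ} (hh : IntegrableOn h (Ioc 0 x)) :
    Integrable (fun z : ℝ × ℝ => iteratedKernel a b x h z.1 z.2)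
      ((volume.restrict (Ioc 0 x)).prod (volume.restrict (Ioc 0 x))) := by
  have hlt : ∀ᵐ s ∂(volume.restrict (Ioc 0 x)), s ∈ Ioo 0 x := by
    rw [← Measure.restrict_congr_set Ioo_ae_eq_Ioc]
    exact ae_restrict_mem measurableSet_Ioo
  have hmeas : AEStronglyMeasurable (fun z : ℝ × ℝ => iteratedKernel a b x h z.1 z.2)
      ((volume.restrict (Ioc 0 x)).prod (volume.restrict (Ioc 0 x))) := by
    refine AEStronglyMeasurable.mul ?_ hh.aestronglyMeasurable.comp_snd
    have hind : (fun z : ℝ × ℝ =>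
        (Ioi z.2).indicator (fun p => (x - p) ^ (a - 1) * (p - z.2) ^ (b - 1)) z.1) =
        {z : ℝ × ℝ | z.2 < z.1}.indicator
          (fun z => (x - z.1) ^ (a - 1) * (z.1 - z.2) ^ (b - 1)) := by
      ext z
      simp [indicator_apply]
    rw [hind]
    exact ((Measurable.indicator (by fun_prop)
      (measurableSet_lt measurable_snd measurable_fst)).aestronglyMeasurable)
  rw [integrable_prod_iff' hmeas]
  refine ⟨hlt.mono fun s hs => integrable_iteratedKernel_left ha hb h hs.1 hs.2, ?_⟩
  have hcont : ContinuousOn (fun s : ℝ => (x - s) ^ (a + b - 1)) (Icc 0 x) :=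
    ((continuous_const.sub continuous_id).rpow_const
      fun _ => Or.inr (by linarith)).continuousOn
  have hint : IntegrableOn (fun s => (x - s) ^ (a + b - 1) * |h s|) (Ioc 0 x) := by
    have hh' : IntegrableOn (fun s => |h s|) (Icc 0 x) :=
      (integrableOn_Icc_iff_integrableOn_Ioc (by finiteness)).2 hh.abs
    exact (hh'.continuousOn_mul hcont isCompact_Icc).mono_set Ioc_subset_Icc_self
  refine (hint.const_mul (ProbabilityTheory.beta a b)).congr (hlt.mono fun s hs => ?_)
  simp only
  rw [← integral_iteratedKernel_left ha hb (fun s => |h s|) hs.1 hs.2]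
  exact setIntegral_congr_fun measurableSet_Ioc fun p hp => (norm_iteratedKernel h hp.2).symm

lemma fracInt_fracInt {a b x : ℝ} (ha : 0 < a) (hb : 0 < b) (hab : 1 ≤ a + b) {h : ℝ → ℝ}
    (hx : 0 ≤ x) (hh : IntegrableOn h (Ioc 0 x)) :
    fracInt a (fracInt b h) x = fracInt (a + b) h x := by
  have hlt : ∀ᵐ s ∂(volume.restrict (Ioc 0 x)), s ∈ Ioo 0 x := by
    rw [← Measure.restrict_congr_set Ioo_ae_eq_Ioc]
    exact ae_restrict_mem measurableSet_Ioo
  have hswap := integral_integral_swap (f := iteratedKernel a b x h)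
    (integrable_iteratedKernel ha hb hab hh)
  have hleft : ∫ p in Ioc 0 x, ∫ s in Ioc 0 x, iteratedKernel a b x h p s =
      Real.Gamma b * ∫ p in (0:ℝ)..x, (x - p) ^ (a - 1) * fracInt b h p := by
    rw [intervalIntegral.integral_of_le hx, ← integral_const_mul]
    refine setIntegral_congr_fun measurableSet_Ioc fun p hp => ?_
    rw [integral_iteratedKernel_right h hp.1 hp.2, fracInt]
    field_simp [(Real.Gamma_pos_of_pos hb).ne']
  have hright : ∫ s in Ioc 0 x, ∫ p in Ioc 0 x, iteratedKernel a b x h p s =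
      ProbabilityTheory.beta a b * ∫ s in (0:ℝ)..x, (x - s) ^ (a + b - 1) * h s := by
    rw [intervalIntegral.integral_of_le hx, ← integral_const_mul]
    exact integral_congr_ae
      (hlt.mono fun s hs => integral_iteratedKernel_left ha hb h hs.1 hs.2)
  rw [hleft, hright, ProbabilityTheory.beta] at hswap
  have hΓa := (Real.Gamma_pos_of_pos ha).ne'
  have hΓb := (Real.Gamma_pos_of_pos hb).ne'
  have hΓab := (Real.Gamma_pos_of_pos (add_pos ha hb)).ne'
  rw [fracInt, fracInt]
  field_simp at hswap ⊢
  linarith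

lemma integrableOn_fracInt {b x : ℝ} (hb : 0 < b) {h : ℝ → ℝ} (hh : IntegrableOn h (Ioc 0 x)) :
    IntegrableOn (fracInt b h) (Ioc 0 x) := by
  have hint := (integrable_iteratedKernel one_pos hb (by linarith) hh).integral_prod_left
  refine (hint.const_mul (1 / Real.Gamma b)).congr
    ((ae_restrict_mem measurableSet_Ioc).mono fun p hp => ?_)
  simp only
  rw [integral_iteratedKernel_right h hp.1 hp.2, fracInt]
  simp

lemma fracInt_congr_ae {a x : ℝ} (hx : 0 ≤ x) {h k : ℝ → ℝ}
    (hhk : h =ᵐ[volume.restrict (Ioc 0 x)] k) : fracInt a h x = fracInt a k x := by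
  rw [fracInt, fracInt, intervalIntegral.integral_of_le hx, intervalIntegral.integral_of_le hx]
  congr 1
  exact integral_congr_ae (hhk.mono fun p hp => by simp only [hp])

lemma fracInt_one (h : ℝ → ℝ) (x : ℝ) : fracInt 1 h x = ∫ s in (0:ℝ)..x, h s := by
  simp [fracInt]

lemma ae_deriv_fracInt_one {h : ℝ → ℝ} (hh : IntegrableOn h (Ioc 0 1)) :
    ∀ᵐ x ∂(volume.restrict (Ioo (0:ℝ) 1)), deriv (fracInt 1 h) x = h x := by
  have hint : IntervalIntegrable h volume 0 1 :=
    (intervalIntegrable_iff_integrableOn_Ioc_of_le zero_le_one).2 hh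
  rw [ae_restrict_iff' measurableSet_Ioo]
  filter_upwards [hint.ae_hasDerivAt_integral] with x hx hx01
  rw [funext (fracInt_one h)]
  exact (hx (by rw [uIcc_of_le zero_le_one]; exact Ioo_subset_Icc_self hx01) 0
    (by simp)).deriv

lemma deriv_congr_of_eqOn_Ioo {F G : ℝ → ℝ} {u v x : ℝ} (h : EqOn F G (Ioo u v))
    (hx : x ∈ Ioo u v) : deriv F x = deriv G x :=
  (h.eventuallyEq_of_mem (isOpen_Ioo.mem_nhds hx)).deriv_eq

/-- The Caputo derivative of an absolutely continuous function is `I^{1-β} f′`. -/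
lemma caputo_ae_eq {β : ℝ} (hβ : β < 1) {f g : ℝ → ℝ} (hg : IntegrableOn g (Ioc 0 1))
    (hf : ∀ x ∈ Icc (0:ℝ) 1, f x - f 0 = fracInt 1 g x) :
    ∀ᵐ x ∂(volume.restrict (Ioo (0:ℝ) 1)), caputo β f x = fracInt (1 - β) g x := by
  have hβ' : 0 < 1 - β := sub_pos.2 hβ
  filter_upwards [ae_deriv_fracInt_one (integrableOn_fracInt hβ' hg),
    ae_restrict_mem measurableSet_Ioo] with x hx hx01
  rw [← hx, caputo]
  refine deriv_congr_of_eqOn_Ioo (fun y hy => ?_) hx01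
  have hgy : IntegrableOn g (Ioc 0 y) := hg.mono_set (Ioc_subset_Ioc_right hy.2.le)
  rw [fracInt_congr_ae hy.1.le ((ae_restrict_mem measurableSet_Ioc).mono fun p hp =>
      hf p ⟨hp.1.le, hp.2.trans hy.2.le⟩),
    fracInt_fracInt hβ' one_pos (by linarith) hy.1.le hgy,
    fracInt_fracInt one_pos hβ' (by linarith) hy.1.le hgy, add_comm]

/-- For `α, β ∈ (0,1)` with `α + β ≤ 1` and `f ∈ AC[0,1]` (with a.e. derivative `g`):
`∂^α (D^β f) = D^{α+β} f` a.e. in `(0,1)` when `α + β < 1`, and `∂^α (D^β f) = f′` a.e. in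
`(0,1)` when `α + β = 1` (the interpretation `D¹ f = f′`).  In particular
`∂^{1−α}(D^α f) = f′` a.e. -/
theorem rlDeriv_caputo_superposition (α β : ℝ) (hα : α ∈ Set.Ioo (0:ℝ) 1)
    (hβ : β ∈ Set.Ioo (0:ℝ) 1) (hαβ : α + β ≤ 1) (f g : ℝ → ℝ)
    (hg : MeasureTheory.IntegrableOn g (Set.Icc 0 1))
    (hf : ∀ x ∈ Set.Icc (0:ℝ) 1, f x = f 0 + ∫ s in (0:ℝ)..x, g s) :
    (α + β < 1 →
      ∀ᵐ x ∂(MeasureTheory.volume.restrict (Set.Ioo (0:ℝ) 1)),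
        rlDeriv α (caputo β f) x = caputo (α + β) f x) ∧
    (α + β = 1 →
      ∀ᵐ x ∂(MeasureTheory.volume.restrict (Set.Ioo (0:ℝ) 1)),
        rlDeriv α (caputo β f) x = g x) := by
  have hg' : IntegrableOn g (Ioc 0 1) := hg.mono_set Ioc_subset_Icc_self
  have hf' : ∀ x ∈ Icc (0:ℝ) 1, f x - f 0 = fracInt 1 g x := fun x hx => by
    rw [hf x hx, fracInt_one, add_sub_cancel_left]
  have hα' : 0 < 1 - α := sub_pos.2 hα.2
  have hβ' : 0 < 1 - β := sub_pos.2 hβ.2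
  have key : EqOn (fracInt (1 - α) (caputo β f)) (fracInt ((1 - α) + (1 - β)) g) (Ioo 0 1) := by
    intro x hx
    have hcap : caputo β f =ᵐ[volume.restrict (Ioc 0 x)] fracInt (1 - β) g :=
      ae_restrict_of_ae_restrict_of_subset
        (fun p hp => (⟨hp.1, hp.2.trans_lt hx.2⟩ : p ∈ Ioo (0:ℝ) 1)) (caputo_ae_eq hβ.2 hg' hf')
    rw [fracInt_congr_ae hx.1.le hcap, fracInt_fracInt hα' hβ' (by linarith) hx.1.le
      (hg'.mono_set (Ioc_subset_Ioc_right hx.2.le))]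
  refine ⟨fun hlt => ?_, fun heq => ?_⟩
  · filter_upwards [ae_restrict_mem measurableSet_Ioo] with x hx
    refine deriv_congr_of_eqOn_Ioo (fun y hy => ?_) hx
    rw [key hy, fracInt_congr_ae hy.1.le ((ae_restrict_mem measurableSet_Ioc).mono fun p hp =>
        hf' p ⟨hp.1.le, hp.2.trans hy.2.le⟩),
      fracInt_fracInt (by linarith) one_pos (by linarith) hy.1.le
        (hg'.mono_set (Ioc_subset_Ioc_right hy.2.le))]
    congr 1
    ring
  · filter_upwards [ae_deriv_fracInt_one hg', ae_restrict_mem measurableSet_Ioo] with x hx hx01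
    rw [← hx, rlDeriv, deriv_congr_of_eqOn_Ioo key hx01]
    congr 2
    linarith
end

section
/- Let α ∈ (0,1), let f, g ∈ AC[0,1] and assume g is Hölder continuous on [0,1] with exponent β for some β ∈ (α,1). Then for almost every x ∈ (0,1), ∂^α(f·g)(x) = g(x)·(∂^α f)(x) + (α/Γ(1−α)) ∫₀^x (x−p)^{−α−1} (g(x) − g(p)) f(p) dp. -/
open MeasureTheory Set

theorem intervalIntegrable_sub_rpow {r : ℝ} (hr : -1 < r) (a b c : ℝ) :
    IntervalIntegrable (fun p => (c - p) ^ r) volume a b := by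
  have h := (intervalIntegral.intervalIntegrable_rpow' hr (a := c - a) (b := c - b)).comp_sub_left c
  simpa using h

theorem integral_sub_rpow {r : ℝ} (hr : -1 < r) (a b : ℝ) :
    ∫ p in a..b, (b - p) ^ r = (b - a) ^ (r + 1) / (r + 1) := by
  rw [intervalIntegral.integral_comp_sub_left (fun u => u ^ r) b,
      integral_rpow (Or.inl hr), sub_self,
    Real.zero_rpow (by linarith), sub_zero]

theorem IntervalIntegrable.of_abs_le_sub_rpow {a b r N : ℝ} (hab : a ≤ b) (hr : -1 < r) {ψ : ℝ → ℝ}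
    (hm : AEStronglyMeasurable ψ (volume.restrict (Ioc a b)))
    (h : ∀ p ∈ Ioc a b, |ψ p| ≤ N * (b - p) ^ r) :
    IntervalIntegrable ψ volume a b := by
  refine ((intervalIntegrable_sub_rpow hr a b b).const_mul N).mono_fun' ?_ ?_
  · rwa [uIoc_of_le hab]
  · rw [uIoc_of_le hab]
    exact (ae_restrict_iff' measurableSet_Ioc).2 (.of_forall h)

theorem abs_integral_le_of_abs_le_sub_rpow {a b r N : ℝ} (hab : a ≤ b) (hr : -1 < r) {ψ : ℝ → ℝ}
    (h : ∀ p ∈ Ioc a b, |ψ p| ≤ N * (b - p) ^ r) :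
    |∫ p in a..b, ψ p| ≤ N * ((b - a) ^ (r + 1) / (r + 1)) := by
  rw [← integral_sub_rpow hr, ← intervalIntegral.integral_const_mul]
  exact intervalIntegral.norm_integral_le_of_norm_le (f := ψ) hab (.of_forall h)
    ((intervalIntegrable_sub_rpow hr a b b).const_mul N)

theorem aestronglyMeasurable_sub_rpow_mul {r b : ℝ} {φ : ℝ → ℝ} {μ : Measure ℝ}
    (hφ : AEStronglyMeasurable φ μ) :
    AEStronglyMeasurable (fun p => (b - p) ^ r * φ p) μ := by
  have h : Measurable fun p : ℝ => (b - p) ^ r := by fun_prop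
  exact h.aestronglyMeasurable.mul hφ

theorem abs_sub_rpow_mul_le {a b r N p : ℝ} {φ : ℝ → ℝ} (h : ∀ p ∈ Ioc a b, |φ p| ≤ N)
    (hp : p ∈ Ioc a b) : |(b - p) ^ r * φ p| ≤ N * (b - p) ^ r := by
  have h0 : 0 ≤ (b - p) ^ r := Real.rpow_nonneg (by linarith [hp.2]) _
  rw [abs_mul, abs_of_nonneg h0, mul_comm]
  exact mul_le_mul_of_nonneg_right (h p hp) h0

/-- The integral `∫₀^x (x - p)^r φ p dp` is monotone in `x` if `φ` is monotone and nonnegative. -/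
theorem MonotoneOn.integral_sub_rpow_mul {r : ℝ} (hr : -1 < r) {φ : ℝ → ℝ}
    (hφ : MonotoneOn φ (Icc 0 1)) (h0 : ∀ p ∈ Icc (0 : ℝ) 1, 0 ≤ φ p) :
    MonotoneOn (fun x => ∫ p in (0 : ℝ)..x, (x - p) ^ r * φ p) (Icc 0 1) := by
  have hint : ∀ x ∈ Icc (0 : ℝ) 1, IntervalIntegrable (fun u => u ^ r * φ (x - u)) volume 0 x := by
    intro x hx
    have hsub : Ioc 0 x ⊆ Icc (0 : ℝ) 1 := fun p hp => ⟨hp.1.le, hp.2.trans hx.2⟩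
    have h : IntervalIntegrable (fun p => (x - p) ^ r * φ p) volume 0 x := by
      refine IntervalIntegrable.of_abs_le_sub_rpow (N := φ 1) hx.1 hr
        (aestronglyMeasurable_sub_rpow_mul ?_) fun p hp => abs_sub_rpow_mul_le ?_ hp
      · exact (aemeasurable_restrict_of_monotoneOn measurableSet_Ioc
          (hφ.mono hsub)).aestronglyMeasurable
      · intro p hp
        rw [abs_of_nonneg (h0 p (hsub hp))]
        exact hφ (hsub hp) (right_mem_Icc.2 zero_le_one) (hsub hp).2
    simpa using (h.comp_sub_left x).symm
  have hsubst : ∀ x, ∫ p in (0 : ℝ)..x, (x - p) ^ r * φ p = ∫ u in (0 : ℝ)..x, u ^ r * φ (x - u) := by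
    intro x
    simpa using intervalIntegral.integral_comp_sub_left (a := 0) (b := x)
      (fun u => u ^ r * φ (x - u)) x
  intro x hx y hy hxy
  simp only [hsubst]
  have hnonneg : ∀ u ∈ Icc 0 y, 0 ≤ u ^ r * φ (y - u) := fun u hu =>
    mul_nonneg (Real.rpow_nonneg hu.1 _) (h0 _ ⟨by linarith [hu.2], by linarith [hu.1, hy.2]⟩)
  have hxs : uIcc 0 x ⊆ uIcc 0 y := by
    rw [uIcc_of_le hx.1, uIcc_of_le hy.1]; exact Icc_subset_Icc_right hxy
  calc ∫ u in (0 : ℝ)..x, u ^ r * φ (x - u)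
      ≤ ∫ u in (0 : ℝ)..x, u ^ r * φ (y - u) := by
        refine intervalIntegral.integral_mono_on hx.1 (hint x hx) ((hint y hy).mono_set hxs) ?_
        intro u hu
        refine mul_le_mul_of_nonneg_left (hφ ?_ ?_ (by linarith)) (Real.rpow_nonneg hu.1 _)
        · exact ⟨by linarith [hu.2], by linarith [hu.1, hx.2]⟩
        · exact ⟨by linarith [hu.2], by linarith [hu.1, hy.2]⟩
    _ ≤ ∫ u in (0 : ℝ)..y, u ^ r * φ (y - u) := by
        refine intervalIntegral.integral_mono_interval le_rfl hx.1 hxy ?_ (hint y hy)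
        exact (ae_restrict_iff' measurableSet_Ioc).2
          (.of_forall fun u hu => hnonneg u (Ioc_subset_Icc_self hu))

theorem MonotoneOn.ae_differentiableAt_integral_sub_rpow_mul {r : ℝ} (hr : -1 < r) {φ : ℝ → ℝ}
    (hφ : MonotoneOn φ (Icc 0 1)) (h0 : ∀ p ∈ Icc (0 : ℝ) 1, 0 ≤ φ p) :
    ∀ᵐ x ∂(volume.restrict (Ioo (0 : ℝ) 1)),
      DifferentiableAt ℝ (fun x => ∫ p in (0 : ℝ)..x, (x - p) ^ r * φ p) x := by
  have h := ((hφ.integral_sub_rpow_mul hr h0).mono Ioo_subset_Icc_self).ae_differentiableWithinAt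
    measurableSet_Ioo
  filter_upwards [h, ae_restrict_mem measurableSet_Ioo] with x hx hxm
  exact hx.differentiableAt (isOpen_Ioo.mem_nhds hxm)

theorem continuousOn_of_eq_add_integral {f f' : ℝ → ℝ} (hf' : IntegrableOn f' (Icc 0 1))
    (hf : ∀ x ∈ Icc (0 : ℝ) 1, f x = f 0 + ∫ s in (0 : ℝ)..x, f' s) :
    ContinuousOn f (Icc 0 1) := by
  have h := intervalIntegral.continuousOn_primitive_interval (a := 0) (b := 1) (μ := volume) (f := f')
    (by rwa [uIcc_of_le zero_le_one])
  rw [uIcc_of_le zero_le_one] at h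
  exact (continuousOn_const.add h).congr hf

theorem intervalIntegrable_sub_rpow_mul {r x : ℝ} (hr : -1 < r) {φ : ℝ → ℝ}
    (hφ : ContinuousOn φ (Icc 0 1)) (hx : x ∈ Icc (0 : ℝ) 1) :
    IntervalIntegrable (fun p => (x - p) ^ r * φ p) volume 0 x := by
  have hsub : Ioc 0 x ⊆ Icc (0 : ℝ) 1 := fun p hp => ⟨hp.1.le, hp.2.trans hx.2⟩
  obtain ⟨N, hN⟩ := isCompact_Icc.exists_bound_of_continuousOn hφ
  exact IntervalIntegrable.of_abs_le_sub_rpow hx.1 hr (aestronglyMeasurable_sub_rpow_mul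
      ((hφ.mono hsub).aestronglyMeasurable measurableSet_Ioc))
    fun p hp => abs_sub_rpow_mul_le (fun q hq => hN q (hsub hq)) hp

theorem monotoneOn_primitive_of_nonneg {h : ℝ → ℝ} (hh : IntegrableOn h (Icc 0 1))
    (h0 : ∀ x, 0 ≤ h x) : MonotoneOn (fun x => ∫ s in (0 : ℝ)..x, h s) (Icc 0 1) := by
  intro x hx y hy hxy
  refine intervalIntegral.integral_mono_interval le_rfl hx.1 hxy (.of_forall h0) ?_
  rw [intervalIntegrable_iff_integrableOn_Icc_of_le hy.1]
  exact hh.mono_set (Icc_subset_Icc_right hy.2)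

/-- The Riemann–Liouville type integral of an absolutely continuous function is differentiable
almost everywhere. -/
theorem ae_differentiableAt_integral_sub_rpow_mul {r : ℝ} (hr : -1 < r) {f f' : ℝ → ℝ}
    (hf' : IntegrableOn f' (Icc 0 1))
    (hf : ∀ x ∈ Icc (0 : ℝ) 1, f x = f 0 + ∫ s in (0 : ℝ)..x, f' s) :
    ∀ᵐ x ∂(volume.restrict (Ioo (0 : ℝ) 1)),
      DifferentiableAt ℝ (fun x => ∫ p in (0 : ℝ)..x, (x - p) ^ r * f p) x := by
  set P : ℝ → ℝ := fun x => ∫ s in (0 : ℝ)..x, max (f' s) 0 with hP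
  set N : ℝ → ℝ := fun x => ∫ s in (0 : ℝ)..x, max (-f' s) 0 with hN
  have hPi : IntegrableOn (fun s => max (f' s) 0) (Icc 0 1) := Integrable.pos_part hf'
  have hNi : IntegrableOn (fun s => max (-f' s) 0) (Icc 0 1) := Integrable.neg_part hf'
  have hPm : MonotoneOn P (Icc 0 1) := monotoneOn_primitive_of_nonneg hPi fun _ => le_max_right _ _
  have hNm : MonotoneOn N (Icc 0 1) := monotoneOn_primitive_of_nonneg hNi fun _ => le_max_right _ _
  have hP0 : ∀ p ∈ Icc (0 : ℝ) 1, 0 ≤ P p := fun p hp =>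
    intervalIntegral.integral_nonneg hp.1 fun _ _ => le_max_right _ _
  have hN0 : ∀ p ∈ Icc (0 : ℝ) 1, 0 ≤ N p := fun p hp =>
    intervalIntegral.integral_nonneg hp.1 fun _ _ => le_max_right _ _
  have hPc : ContinuousOn P (Icc 0 1) := continuousOn_of_eq_add_integral hPi (by simp [hP])
  have hNc : ContinuousOn N (Icc 0 1) := continuousOn_of_eq_add_integral hNi (by simp [hN])
  have hdec : ∀ p ∈ Icc (0 : ℝ) 1, f p = f 0 * 1 + P p - N p := by
    intro p hp
    have hi : ∀ {h : ℝ → ℝ}, IntegrableOn h (Icc 0 1) → IntervalIntegrable h volume 0 p := by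
      intro h hh
      rw [intervalIntegrable_iff_integrableOn_Icc_of_le hp.1]
      exact hh.mono_set (Icc_subset_Icc_right hp.2)
    rw [hf p hp, mul_one, add_sub_assoc, hP, hN, ← intervalIntegral.integral_sub (hi hPi) (hi hNi)]
    congr 2
    ext s
    rcases le_total (f' s) 0 with h | h
    · rw [max_eq_right h, max_eq_left (by linarith)]; ring
    · rw [max_eq_left h, max_eq_right (by linarith)]; ring
  have h1 := (monotoneOn_const (c := (1 : ℝ)) (s := Icc (0 : ℝ) 1)).ae_differentiableAt_integral_sub_rpow_mul
      hr (by simp)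
  filter_upwards [h1, hPm.ae_differentiableAt_integral_sub_rpow_mul hr hP0,
    hNm.ae_differentiableAt_integral_sub_rpow_mul hr hN0, ae_restrict_mem measurableSet_Ioo]
    with x hx1 hxP hxN hx
  refine (((hx1.const_mul (f 0)).add hxP).sub hxN).congr_of_eventuallyEq ?_
  filter_upwards [isOpen_Ioo.mem_nhds hx] with y hy
  have hy' : y ∈ Icc (0 : ℝ) 1 := Ioo_subset_Icc_self hy
  have i1 := (intervalIntegrable_sub_rpow_mul hr (φ := fun _ => (1 : ℝ)) continuousOn_const
    hy').const_mul (f 0)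
  have iP := intervalIntegrable_sub_rpow_mul hr hPc hy'
  have iN := intervalIntegrable_sub_rpow_mul hr hNc hy'
  simp only [Pi.add_apply, Pi.sub_apply]
  rw [← intervalIntegral.integral_const_mul, ← intervalIntegral.integral_add i1 iP,
    ← intervalIntegral.integral_sub (i1.add iP) iN]
  refine intervalIntegral.integral_congr fun p hp => ?_
  rw [uIcc_of_le hy'.1] at hp
  rw [hdec p ⟨hp.1, hp.2.trans hy'.2⟩]
  ring

theorem abs_one_add_rpow_neg_sub_le {α t : ℝ} (hα : α ∈ Ioo (0 : ℝ) 1) (ht : -(1 / 2) ≤ t) :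
    |(1 + t) ^ (-α) - 1 + α * t| ≤ 2 * t ^ 2 := by
  obtain ⟨h0, h1⟩ := hα
  have ht0 : 0 < 1 + t := by linarith
  have hat : 0 < 1 + α * t := by nlinarith
  rw [abs_le]
  constructor
  · have hle : (1 + t) ^ α ≤ 1 + α * t :=
      rpow_one_add_le_one_add_mul_self (by linarith) h0.le h1.le
    have : 1 - α * t ≤ (1 + t) ^ (-α) := by
      rw [Real.rpow_neg ht0.le]
      refine le_trans ?_ (inv_anti₀ (Real.rpow_pos_of_pos ht0 α) hle)
      rw [← one_div, le_div_iff₀ hat]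
      nlinarith [sq_nonneg (α * t)]
    nlinarith [sq_nonneg t]
  · have hle : (1 + t) ^ (1 - α) ≤ 1 + (1 - α) * t :=
      rpow_one_add_le_one_add_mul_self (by linarith) (by linarith) (by linarith)
    have heq : (1 + t) ^ (-α) = (1 + t) ^ (1 - α) / (1 + t) := by
      rw [← Real.rpow_sub_one ht0.ne']; congr 1; ring
    have : (1 + t) ^ (-α) ≤ 2 * t ^ 2 + 1 - α * t := by
      rw [heq, div_le_iff₀ ht0]
      nlinarith [mul_nonneg (sq_nonneg t) (by linarith : 0 ≤ 1 + 2 * t),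
        mul_nonneg (sq_nonneg t) (by linarith : 0 ≤ 1 - α)]
    linarith

theorem abs_sub_rpow_taylor_le {α s d : ℝ} (hα : α ∈ Ioo (0 : ℝ) 1) (hs : 0 < s)
    (hd : 2 * |d| ≤ s) :
    |(s + d) ^ (-α) - s ^ (-α) + α * d * s ^ (-α - 1)| ≤ 2 * d ^ 2 * s ^ (-α - 2) := by
  have ht : -(1 / 2) ≤ d / s := by
    rw [le_div_iff₀ hs]; linarith [neg_abs_le d]
  have key := abs_one_add_rpow_neg_sub_le hα ht
  have h1 : (s + d) ^ (-α) = s ^ (-α) * (1 + d / s) ^ (-α) := by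
    rw [← Real.mul_rpow hs.le (by linarith)]
    congr 1; field_simp
  have h2 : s ^ (-α - 1) = s ^ (-α) / s := Real.rpow_sub_one hs.ne' _
  have h3 : s ^ (-α - 2) = s ^ (-α) / s ^ 2 := by
    rw [Real.rpow_sub hs, Real.rpow_two]
  have h4 : (s + d) ^ (-α) - s ^ (-α) + α * d * s ^ (-α - 1) =
      s ^ (-α) * ((1 + d / s) ^ (-α) - 1 + α * (d / s)) := by
    rw [h1, h2]; ring
  have hpos : 0 ≤ s ^ (-α) := Real.rpow_nonneg hs.le _
  rw [h4, abs_mul, abs_of_nonneg hpos, h3]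
  calc _ ≤ s ^ (-α) * (2 * (d / s) ^ 2) := mul_le_mul_of_nonneg_left key hpos
    _ = _ := by field_simp

theorem abs_integral_le_of_abs_le_sub_rpow_of_lt_neg_one {a c b r N : ℝ} (hac : a ≤ c) (hcb : c < b)
    (hr : r < -1) (hN : 0 ≤ N) {ψ : ℝ → ℝ} (h : ∀ p ∈ Ioc a c, |ψ p| ≤ N * (b - p) ^ r) :
    |∫ p in a..c, ψ p| ≤ N * ((b - c) ^ (r + 1) / -(r + 1)) := by
  have h0 : (0 : ℝ) ∉ uIcc (b - c) (b - a) := by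
    rw [uIcc_of_le (by linarith)]; exact fun h => by linarith [h.1]
  have hi : IntervalIntegrable (fun p => (b - p) ^ r) volume a c := by
    refine ContinuousOn.intervalIntegrable fun p hp => ?_
    rw [uIcc_of_le hac] at hp
    exact ((continuousAt_const.sub continuousAt_id).rpow_const
      (Or.inl (sub_pos.2 (hp.2.trans_lt hcb)).ne')).continuousWithinAt
  have heval : ∫ p in a..c, (b - p) ^ r = ((b - a) ^ (r + 1) - (b - c) ^ (r + 1)) / (r + 1) := by
    rw [intervalIntegral.integral_comp_sub_left (fun u => u ^ r) b,
      integral_rpow (Or.inr ⟨hr.ne, h0⟩)]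
  calc |∫ p in a..c, ψ p| ≤ ∫ p in a..c, N * (b - p) ^ r :=
        intervalIntegral.norm_integral_le_of_norm_le (f := ψ) hac (.of_forall h) (hi.const_mul N)
    _ = N * (((b - c) ^ (r + 1) - (b - a) ^ (r + 1)) / -(r + 1)) := by
        rw [intervalIntegral.integral_const_mul, heval, ← neg_sub ((b - c) ^ (r + 1)), neg_div, div_neg]
    _ ≤ _ := by
        refine mul_le_mul_of_nonneg_left (div_le_div_of_nonneg_right ?_ (by linarith)) hN
        linarith [Real.rpow_nonneg (by linarith : (0 : ℝ) ≤ b - a) (r + 1)]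

theorem abs_sub_rpow_mul_le_of_abs_le {r β M x p : ℝ} {φ : ℝ → ℝ} (hr : r ≠ 0) (hM : 0 ≤ M)
    (hp : p ≤ x) (h : |φ p| ≤ M * |x - p| ^ β) :
    |(x - p) ^ r * φ p| ≤ M * (x - p) ^ (β + r) := by
  rcases hp.eq_or_lt with rfl | hlt
  · rw [sub_self, Real.zero_rpow hr, zero_mul, abs_zero]
    exact mul_nonneg hM (Real.rpow_nonneg le_rfl _)
  · have hs : 0 < x - p := sub_pos.2 hlt
    rw [abs_of_pos hs] at h
    rw [abs_mul, abs_of_nonneg (Real.rpow_nonneg hs.le r), Real.rpow_add hs]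
    calc _ ≤ (x - p) ^ r * (M * (x - p) ^ β) :=
          mul_le_mul_of_nonneg_left h (Real.rpow_nonneg hs.le r)
      _ = _ := by ring

theorem abs_integral_sub_rpow_mul_taylor_le {α β M x y : ℝ} {φ : ℝ → ℝ} (hα : α ∈ Ioo (0 : ℝ) 1)
    (hβ : β ∈ Ioo α 1) (hx : x ∈ Ioo (0 : ℝ) 1) (hφ : ContinuousOn φ (Icc 0 1)) (hM : 0 ≤ M)
    (hbound : ∀ p ∈ Icc (0 : ℝ) 1, |φ p| ≤ M * |x - p| ^ β) (hyx : y ≠ x)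
    (hy : y ∈ Icc (0 : ℝ) 1) (hd : 2 * |y - x| < x) :
    |(∫ p in (0 : ℝ)..y, (y - p) ^ (-α) * φ p) - (∫ p in (0 : ℝ)..x, (x - p) ^ (-α) * φ p) +
        α * (y - x) * ∫ p in (0 : ℝ)..x, (x - p) ^ (-α - 1) * φ p| ≤
      M * (2 ^ (β - α) / (1 + α - β) + 2 ^ β * 3 ^ (1 - α) / (1 - α) +
        2 ^ β * 2 ^ (1 - α) / (1 - α) + α * 2 ^ (β - α) / (β - α)) * |y - x| ^ (1 + β - α) := by
  obtain ⟨h0, h1⟩ := hα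
  obtain ⟨hαβ, hβ1⟩ := hβ
  obtain ⟨hx0, hx1⟩ := hx
  set h := |y - x| with hh
  have hpos : 0 < h := abs_pos.2 (sub_ne_zero.2 hyx)
  have hyle : y ≤ x + h := by linarith [le_abs_self (y - x)]
  have hyge : x - h ≤ y := by linarith [neg_abs_le (y - x)]
  set c := x - 2 * h with hc
  have hc0 : 0 < c := by linarith
  have hx' : x ∈ Icc (0 : ℝ) 1 := ⟨hx0.le, hx1.le⟩
  have hcx : c ≤ x := by linarith
  have hcy : c ≤ y := by linarith
  -- integrability of the three integrands
  have iy := intervalIntegrable_sub_rpow_mul (r := -α) (by linarith) hφ hy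
  have ix := intervalIntegrable_sub_rpow_mul (r := -α) (by linarith) hφ hx'
  have hb1 : ∀ p ∈ Ioc 0 x, |(x - p) ^ (-α - 1) * φ p| ≤ M * (x - p) ^ (β + (-α - 1)) :=
    fun p hp => abs_sub_rpow_mul_le_of_abs_le (by linarith) hM hp.2
      (hbound p ⟨hp.1.le, hp.2.trans hx1.le⟩)
  have id : IntervalIntegrable (fun p => (x - p) ^ (-α - 1) * φ p) volume 0 x := by
    refine IntervalIntegrable.of_abs_le_sub_rpow hx0.le (by linarith)
      (aestronglyMeasurable_sub_rpow_mul ?_) hb1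
    exact (hφ.mono fun p hp => ⟨hp.1.le, hp.2.trans hx1.le⟩).aestronglyMeasurable measurableSet_Ioc
  have subl : ∀ {z : ℝ}, c ≤ z → uIcc 0 c ⊆ uIcc 0 z := by
    intro z hz
    rw [uIcc_of_le hc0.le, uIcc_of_le (hc0.le.trans hz)]; exact Icc_subset_Icc_right hz
  have subr : ∀ {z : ℝ}, c ≤ z → uIcc c z ⊆ uIcc 0 z := by
    intro z hz
    rw [uIcc_of_le hz, uIcc_of_le (hc0.le.trans hz)]; exact Icc_subset_Icc_left hc0.le
  have iy1 := iy.mono_set (subl hcy)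
  have ix1 := ix.mono_set (subl hcx)
  have id1 := id.mono_set (subl hcx)
  rw [← intervalIntegral.integral_add_adjacent_intervals iy1 (iy.mono_set (subr hcy)),
    ← intervalIntegral.integral_add_adjacent_intervals ix1 (ix.mono_set (subr hcx)),
    ← intervalIntegral.integral_add_adjacent_intervals id1 (id.mono_set (subr hcx))]
  -- the main part
  have hmain : |∫ p in (0 : ℝ)..c, ((y - p) ^ (-α) * φ p - (x - p) ^ (-α) * φ p +
      α * (y - x) * ((x - p) ^ (-α - 1) * φ p))| ≤
      M * (2 ^ (β - α) / (1 + α - β)) * h ^ (1 + β - α) := by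
    refine (abs_integral_le_of_abs_le_sub_rpow_of_lt_neg_one (b := x) (r := β - α - 2)
      (N := 2 * M * h ^ 2) hc0.le (by linarith) (by linarith) (by positivity) ?_).trans_eq ?_
    · intro p hp
      have hs : 0 < x - p := by linarith [hp.2]
      have ht := abs_sub_rpow_taylor_le (d := y - x) ⟨h0, h1⟩ hs (by rw [← hh]; linarith [hp.2])
      rw [show x - p + (y - x) = y - p by ring, ← sq_abs, ← hh] at ht
      have hφp := hbound p ⟨hp.1.le, by linarith [hp.2]⟩
      rw [abs_of_pos hs] at hφp
      calc _ = |(y - p) ^ (-α) - (x - p) ^ (-α) + α * (y - x) * (x - p) ^ (-α - 1)| * |φ p| := by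
            rw [← abs_mul]; congr 1; ring
        _ ≤ (2 * h ^ 2 * (x - p) ^ (-α - 2)) * (M * (x - p) ^ β) := by gcongr
        _ = 2 * M * h ^ 2 * ((x - p) ^ β * (x - p) ^ (-α - 2)) := by ring
        _ = _ := by rw [← Real.rpow_add hs]; congr 2; ring
    · have e1 : x - c = 2 * h := by rw [hc]; ring
      have e2 : -(β - α - 2 + 1) = 1 + α - β := by ring
      have e3 : β - α - 2 + 1 = β - α - 1 := by ring
      have e4 : 1 + β - α = β - α + 1 := by ring
      rw [e1, e2, e3, Real.mul_rpow two_pos.le hpos.le, Real.rpow_sub_one two_ne_zero,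
        Real.rpow_sub_one hpos.ne', e4, Real.rpow_add_one hpos.ne']
      field_simp
  -- the tails
  have htail : ∀ p ∈ Icc c (x + h), p ∈ Icc (0 : ℝ) 1 → |φ p| ≤ M * (2 * h) ^ β := by
    intro p hp hp'
    refine (hbound p hp').trans ?_
    have : |x - p| ≤ 2 * h := by rw [abs_le]; constructor <;> linarith [hp.1, hp.2]
    have := Real.rpow_le_rpow (abs_nonneg _) this (by linarith : 0 ≤ β)
    gcongr
  have hpow : ∀ k : ℝ, 0 < k → (2 * h) ^ β * (k * h) ^ (1 - α) =
      2 ^ β * k ^ (1 - α) * h ^ (1 + β - α) := by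
    intro k hk
    rw [Real.mul_rpow two_pos.le hpos.le, Real.mul_rpow hk.le hpos.le,
      show 1 + β - α = β + (1 - α) by ring, Real.rpow_add hpos]
    ring
  have hT : ∀ (z k : ℝ), 0 < k → c ≤ z → z ≤ x + h → z ≤ 1 → z - c ≤ k * h →
      |∫ p in c..z, (z - p) ^ (-α) * φ p| ≤
        M * (2 ^ β * k ^ (1 - α) / (1 - α)) * h ^ (1 + β - α) := by
    intro z k hk hcz hzx hz1 hzc
    refine (abs_integral_le_of_abs_le_sub_rpow hcz (by linarith)
      fun p hp => abs_sub_rpow_mul_le (N := M * (2 * h) ^ β) (fun q hq => ?_) hp).trans ?_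
    · exact htail q ⟨hq.1.le, hq.2.trans hzx⟩ ⟨by linarith [hq.1], hq.2.trans hz1⟩
    · have e : -α + 1 = 1 - α := by ring
      have hα_pos : 0 < 1 - α := by linarith
      have := Real.rpow_le_rpow (sub_nonneg.2 hcz) hzc hα_pos.le
      rw [e]
      calc _ ≤ M * (2 * h) ^ β * ((k * h) ^ (1 - α) / (1 - α)) := by gcongr
        _ = M * ((2 * h) ^ β * (k * h) ^ (1 - α)) / (1 - α) := by ring
        _ = _ := by rw [hpow k hk]; ring
  have hTy := hT y 3 (by norm_num) hcy hyle hy.2 (by linarith)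
  have hTx := hT x 2 (by norm_num) hcx (by linarith) hx1.le (by linarith)
  have hTd : |α * (y - x) * ∫ p in c..x, (x - p) ^ (-α - 1) * φ p| ≤
      M * (α * 2 ^ (β - α) / (β - α)) * h ^ (1 + β - α) := by
    have := abs_integral_le_of_abs_le_sub_rpow hcx (by linarith)
      fun p hp => hb1 p ⟨hc0.trans hp.1, hp.2⟩
    rw [show x - c = 2 * h by rw [hc]; ring, show β + (-α - 1) + 1 = β - α by ring] at this
    rw [abs_mul, abs_mul, abs_of_pos h0, ← hh]
    calc _ ≤ α * h * (M * ((2 * h) ^ (β - α) / (β - α))) := by gcongr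
      _ = _ := by
        rw [Real.mul_rpow two_pos.le hpos.le, show 1 + β - α = β - α + 1 by ring,
          Real.rpow_add_one hpos.ne']
        ring
  rw [intervalIntegral.integral_add (iy1.sub ix1) (id1.const_mul _),
    intervalIntegral.integral_sub iy1 ix1, intervalIntegral.integral_const_mul] at hmain
  rw [abs_le] at *
  constructor <;> linarith [hmain.1, hmain.2, hTy.1, hTy.2, hTx.1, hTx.2, hTd.1, hTd.2]

/-- Differentiation of `∫₀^y (y - p)^(-α) φ p dp` at a point where `φ` vanishes to order
`β > α`. -/
theorem hasDerivAt_integral_sub_rpow_mul {α β M x : ℝ} {φ : ℝ → ℝ} (hα : α ∈ Ioo (0 : ℝ) 1)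
    (hβ : β ∈ Ioo α 1) (hx : x ∈ Ioo (0 : ℝ) 1) (hφ : ContinuousOn φ (Icc 0 1)) (hM : 0 ≤ M)
    (hbound : ∀ p ∈ Icc (0 : ℝ) 1, |φ p| ≤ M * |x - p| ^ β) :
    HasDerivAt (fun y => ∫ p in (0 : ℝ)..y, (y - p) ^ (-α) * φ p)
      (-α * ∫ p in (0 : ℝ)..x, (x - p) ^ (-α - 1) * φ p) x := by
  obtain ⟨K, hK⟩ : ∃ K : ℝ, ∀ y ∈ Icc (0 : ℝ) 1, 2 * |y - x| < x → y ≠ x →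
      |(∫ p in (0 : ℝ)..y, (y - p) ^ (-α) * φ p) - (∫ p in (0 : ℝ)..x, (x - p) ^ (-α) * φ p) +
        α * (y - x) * ∫ p in (0 : ℝ)..x, (x - p) ^ (-α - 1) * φ p| ≤ K * |y - x| ^ (1 + β - α) :=
    ⟨_, fun y hy hd hyx =>
      abs_integral_sub_rpow_mul_taylor_le hα hβ hx hφ hM hbound hyx hy hd⟩
  have hε : 0 < β - α := sub_pos.2 hβ.1
  rw [hasDerivAt_iff_tendsto_slope]
  rw [tendsto_iff_norm_sub_tendsto_zero]
  have hlim : Filter.Tendsto (fun y => K * |y - x| ^ (β - α)) (nhdsWithin x {x}ᶜ) (nhds 0) := by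
    have hc : ContinuousAt (fun y => K * |y - x| ^ (β - α)) x :=
      continuousAt_const.mul (((continuousAt_id.sub continuousAt_const).abs).rpow_const
        (Or.inr hε.le))
    have := hc.tendsto
    rw [sub_self, abs_zero, Real.zero_rpow hε.ne', mul_zero] at this
    exact this.mono_left nhdsWithin_le_nhds
  refine squeeze_zero' (.of_forall fun _ => norm_nonneg _) ?_ hlim
  have hnear : ∀ᶠ y in nhds x, 2 * |y - x| < x := by
    have hc : ContinuousAt (fun y => 2 * |y - x|) x := by fun_prop
    exact hc.eventually_lt continuousAt_const (by simpa using hx.1)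
  filter_upwards [self_mem_nhdsWithin, nhdsWithin_le_nhds hnear,
    nhdsWithin_le_nhds (Icc_mem_nhds hx.1 hx.2)] with y hne hd hy
  have hyx : y - x ≠ 0 := sub_ne_zero.2 hne
  have hpos : 0 < |y - x| := abs_pos.2 hyx
  have := hK y hy hd hne
  rw [slope_def_field, Real.norm_eq_abs]
  refine le_of_mul_le_mul_right ?_ hpos
  rw [← abs_mul, mul_assoc, ← Real.rpow_add_one hpos.ne', show β - α + 1 = 1 + β - α by ring]
  refine le_of_eq_of_le (congrArg _ ?_) this
  rw [sub_mul, div_mul_cancel₀ _ hyx]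
  ring

/-- Product rule: for `α ∈ (0,1)`, `f, g ∈ AC[0,1]` with `g` Hölder of exponent `β ∈ (α,1)`,
for a.e. `x ∈ (0,1)`:
`∂^α(f·g)(x) = g(x) (∂^α f)(x) + (α/Γ(1−α)) ∫₀^x (x−p)^{−α−1}(g(x)−g(p)) f(p) dp`. -/
theorem rlDeriv_mul (α β : ℝ) (hα : α ∈ Set.Ioo (0:ℝ) 1) (hβ : β ∈ Set.Ioo α 1)
    (f g f' g' : ℝ → ℝ)
    (hf' : MeasureTheory.IntegrableOn f' (Set.Icc 0 1))
    (hf : ∀ x ∈ Set.Icc (0:ℝ) 1, f x = f 0 + ∫ s in (0:ℝ)..x, f' s)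
    (hg' : MeasureTheory.IntegrableOn g' (Set.Icc 0 1))
    (hg : ∀ x ∈ Set.Icc (0:ℝ) 1, g x = g 0 + ∫ s in (0:ℝ)..x, g' s)
    (C : ℝ) (hC : 0 ≤ C)
    (hHolder : ∀ x ∈ Set.Icc (0:ℝ) 1, ∀ y ∈ Set.Icc (0:ℝ) 1, |g x - g y| ≤ C * |x - y| ^ β) :
    ∀ᵐ x ∂(MeasureTheory.volume.restrict (Set.Ioo (0:ℝ) 1)),
      rlDeriv α (fun y => f y * g y) x =
        g x * rlDeriv α f x +
          (α / Real.Gamma (1 - α)) *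
            ∫ p in (0:ℝ)..x, (x - p) ^ (-α - 1) * (g x - g p) * f p := by
  have hfc := continuousOn_of_eq_add_integral hf' hf
  have hgc := continuousOn_of_eq_add_integral hg' hg
  obtain ⟨B, hB⟩ := isCompact_Icc.exists_bound_of_continuousOn hfc
  have hB0 : 0 ≤ B := (norm_nonneg _).trans (hB 0 (left_mem_Icc.2 zero_le_one))
  have hfrac : ∀ (h : ℝ → ℝ) (y : ℝ), fracInt (1 - α) h y =
      (1 / Real.Gamma (1 - α)) * ∫ p in (0 : ℝ)..y, (y - p) ^ (-α) * h p := by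
    intro h y
    rw [fracInt, show 1 - α - 1 = -α by ring]
  have hr : -1 < -α := by linarith [hα.2]
  filter_upwards [ae_differentiableAt_integral_sub_rpow_mul hr hf' hf,
    ae_restrict_mem measurableSet_Ioo] with x hdiff hx
  have hx' : x ∈ Icc (0 : ℝ) 1 := Ioo_subset_Icc_self hx
  have hφc : ContinuousOn (fun p => (g x - g p) * f p) (Icc 0 1) :=
    (continuousOn_const.sub hgc).mul hfc
  have hK := hasDerivAt_integral_sub_rpow_mul (M := C * B) hα hβ hx hφc (by positivity) (by
    intro p hp
    rw [abs_mul, mul_right_comm]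
    exact mul_le_mul (hHolder x hx' p hp) (hB p hp) (abs_nonneg _) (by positivity))
  have hF := hdiff.hasDerivAt
  have hderf : rlDeriv α f x = (1 / Real.Gamma (1 - α)) *
      deriv (fun y => ∫ p in (0 : ℝ)..y, (y - p) ^ (-α) * f p) x := by
    rw [rlDeriv, funext (hfrac f)]
    exact (hF.const_mul _).deriv
  have hderfg := ((hF.const_mul (g x)).sub hK).const_mul (1 / Real.Gamma (1 - α))
  have heq : fracInt (1 - α) (fun y => f y * g y) =ᶠ[nhds x] fun y => 1 / Real.Gamma (1 - α) *
      (g x * (∫ p in (0 : ℝ)..y, (y - p) ^ (-α) * f p) -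
        ∫ p in (0 : ℝ)..y, (y - p) ^ (-α) * ((g x - g p) * f p)) := by
    filter_upwards [Icc_mem_nhds hx.1 hx.2] with y hy
    rw [hfrac, ← intervalIntegral.integral_const_mul (g x), ← intervalIntegral.integral_sub
      ((intervalIntegrable_sub_rpow_mul hr hfc hy).const_mul _)
      (intervalIntegrable_sub_rpow_mul hr hφc hy)]
    congr 2
    ext p
    ring
  rw [hderf, rlDeriv, heq.deriv_eq]
  refine hderfg.deriv.trans ?_
  simp only [mul_assoc]
  ring
end
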